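/- arXiv:2202.03100 — 2 statements merged into one kernel-verified Lean document; each statement's English description precedes it below -/
import Mathlib

section
/- Let 𝒳, 𝒴, 𝓑 be finite sets, π_{XY} a probability distribution on 𝒳×𝒴 with marginal π_X and conditional π_{Y|X}. For t ∈ ℝ define Ψ(t) as the minimum, over all finite auxiliary alphabets 𝒰, 𝒱 and all distributions P_{UV} on 𝒰×𝒱 and conditional distributions P_{B|XUV} (B ∈ 𝓑) and P_{Y|BUV} satisfying H(U|V) ≤ H(BU|XYV) + t, of D(P_{Y|XV} ‖ π_{Y|X} | π_X P_V), where all entropies and the distribution P_{Y|XV} are evaluated under the joint distribution π_X P_{UV} P_{B|XUV} P_{Y|BUV} (and Ψ(t) = +∞ if no feasible tuple exists). Then the function Ψ : ℝ → [0, +∞] is convex and nonincreasing on ℝ. -/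
open scoped BigOperators ENNReal
open Classical

noncomputable section

/-- `p` is a probability mass function on the finite type `α`. -/
def IsDist {α : Type} [Fintype α] (p : α → ℝ) : Prop :=
  (∀ a, 0 ≤ p a) ∧ (∑ a, p a) = 1

/-- `k` is a conditional probability kernel. -/
def IsKernel {α β : Type} [Fintype β] (k : α → β → ℝ) : Prop :=
  ∀ a, (∀ b, 0 ≤ k a b) ∧ (∑ b, k a b) = 1

/-- Marginal (pushforward) of `p` along the map `f`. -/
def marg {α β : Type} [Fintype α] (f : α → β) (p : α → ℝ) : β → ℝ :=
  fun b => ∑ a, if f a = b then p a else 0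

/-- Shannon entropy (natural log). -/
def ent {α : Type} [Fintype α] (p : α → ℝ) : ℝ :=
  ∑ a, Real.negMulLog (p a)

/-- Conditional entropy `H(f(A) | g(A))` for `A ∼ p`. -/
def condEnt {α β γ : Type} [Fintype α] [Fintype β] [Fintype γ]
    (f : α → β) (g : α → γ) (p : α → ℝ) : ℝ :=
  ent (marg (fun a => (f a, g a)) p) - ent (marg g p)

/-- Kullback–Leibler divergence `D(p‖q)` with value `⊤` if `p` is not absolutely
continuous with respect to `q`. -/
def KL {α : Type} [Fintype α] (p q : α → ℝ) : ℝ≥0∞ :=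
  if ∀ a, q a = 0 → p a = 0 then ENNReal.ofReal (∑ a, p a * Real.log (p a / q a)) else ⊤

/-- The joint distribution `π_X P_{UV} P_{B|XUV} P_{Y|BUV}` on `X × U × V × B × Y`. -/
def seqJoint {X Y B U V : Type} (πX : X → ℝ) (PUV : U × V → ℝ)
    (PB : X × U × V → B → ℝ) (PY : B × U × V → Y → ℝ) : X × U × V × B × Y → ℝ :=
  fun q => πX q.1 * PUV (q.2.1, q.2.2.1) * PB (q.1, q.2.1, q.2.2.1) q.2.2.2.1 *
    PY (q.2.2.2.1, q.2.1, q.2.2.1) q.2.2.2.2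

/-- The set of values `D(P_{Y|XV} ‖ π_{Y|X} | π_X P_V)` over all feasible tuples
`(𝒰, 𝒱, P_{UV}, P_{B|XUV}, P_{Y|BUV})` with `H(U|V) ≤ H(BU|XYV) + t`. -/
def psiSet (X Y B : Type) [Fintype X] [Fintype Y] [Fintype B] (π : X × Y → ℝ) (t : ℝ) :
    Set ℝ≥0∞ :=
  { d | ∃ (m l : ℕ) (PUV : Fin m × Fin l → ℝ)
      (PB : X × Fin m × Fin l → B → ℝ) (PY : B × Fin m × Fin l → Y → ℝ),
      IsDist PUV ∧ IsKernel PB ∧ IsKernel PY ∧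
      condEnt (fun q : X × Fin m × Fin l × B × Y => q.2.1)
          (fun q => q.2.2.1) (seqJoint (marg Prod.fst π) PUV PB PY) ≤
        condEnt (fun q : X × Fin m × Fin l × B × Y => (q.2.2.2.1, q.2.1))
          (fun q => (q.1, q.2.2.2.2, q.2.2.1)) (seqJoint (marg Prod.fst π) PUV PB PY) + t ∧
      d = KL (marg (fun q : X × Fin m × Fin l × B × Y => (q.1, q.2.2.1, q.2.2.2.2))
              (seqJoint (marg Prod.fst π) PUV PB PY))
            (fun r : X × Fin l × Y => marg Prod.snd PUV r.2.1 * π (r.1, r.2.2)) }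

/-- `Ψ(t)`, with the convention `Ψ(t) = ⊤` when there is no feasible tuple. -/
def Psi (X Y B : Type) [Fintype X] [Fintype Y] [Fintype B] (π : X × Y → ℝ) (t : ℝ) : ℝ≥0∞ :=
  sInf (psiSet X Y B π t)

section Mixture

variable {α β γ δ : Type}

lemma sum_marg [Fintype α] [Fintype β] (f : α → β) (p : α → ℝ) :
    ∑ b, marg f p b = ∑ a, p a := by
  simp only [marg]
  rw [Finset.sum_comm]
  simp

lemma marg_marg [Fintype α] [Fintype β] (g : β → γ) (f : α → β) (p : α → ℝ) :
    marg g (marg f p) = marg (g ∘ f) p := by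
  funext c
  simp only [marg, Function.comp]
  have h : ∀ b, (if g b = c then ∑ a, (if f a = b then p a else 0) else 0) =
      ∑ a, if f a = b then (if g (f a) = c then p a else 0) else 0 := by
    intro b
    by_cases hb : g b = c
    · rw [if_pos hb]
      refine Finset.sum_congr rfl fun a _ => ?_
      by_cases ha : f a = b
      · subst ha; simp [hb]
      · simp [ha]
    · rw [if_neg hb]
      refine (Finset.sum_eq_zero fun a _ => ?_).symm
      by_cases ha : f a = b
      · subst ha; simp [hb]
      · simp [ha]
  simp only [h]
  rw [Finset.sum_comm]
  simp

lemma marg_apply_of_injective [Fintype α] {e : α → β} (he : Function.Injective e)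
    (p : α → ℝ) (a : α) : marg e p (e a) = p a := by
  simp [marg, he.eq_iff]

lemma marg_apply_of_notMem_range [Fintype α] {e : α → β} (p : α → ℝ) {b : β}
    (hb : b ∉ Set.range e) : marg e p b = 0 :=
  Finset.sum_eq_zero fun a _ => if_neg fun h => hb ⟨a, h⟩

lemma eq_marg_of_injective [Fintype α] {e : α → β} (he : Function.Injective e) {p : α → ℝ}
    {r : β → ℝ} (h : ∀ a, r (e a) = p a) (h' : ∀ b, b ∉ Set.range e → r b = 0) :
    r = marg e p := by
  funext b
  by_cases hb : b ∈ Set.range e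
  · obtain ⟨a, rfl⟩ := hb
    rw [h, marg_apply_of_injective he]
  · rw [h' b hb, marg_apply_of_notMem_range p hb]

lemma ent_marg_of_injective [Fintype α] [Fintype β] {e : α → β} (he : Function.Injective e)
    (p : α → ℝ) : ent (marg e p) = ent p := by
  refine (Fintype.sum_of_injective e he _ _ (fun b hb => ?_) fun a => ?_).symm
  · rw [marg_apply_of_notMem_range p hb, Real.negMulLog_zero]
  · rw [marg_apply_of_injective he]

lemma KL_marg_of_injective [Fintype α] [Fintype β] {e : α → β} (he : Function.Injective e)
    (p q : α → ℝ) : KL (marg e p) (marg e q) = KL p q := by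
  have hac : (∀ b, marg e q b = 0 → marg e p b = 0) ↔ ∀ a, q a = 0 → p a = 0 := by
    constructor
    · intro h a
      simpa only [marg_apply_of_injective he] using h (e a)
    · intro h b
      by_cases hb : b ∈ Set.range e
      · obtain ⟨a, rfl⟩ := hb
        simpa only [marg_apply_of_injective he] using h a
      · exact fun _ => marg_apply_of_notMem_range p hb
  have hsum : ∑ b, marg e p b * Real.log (marg e p b / marg e q b) =
      ∑ a, p a * Real.log (p a / q a) := by
    refine (Fintype.sum_of_injective e he _ _ (fun b hb => ?_) fun a => ?_).symm
    · rw [marg_apply_of_notMem_range p hb, zero_mul]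
    · rw [marg_apply_of_injective he, marg_apply_of_injective he]
  simp only [KL, hac, hsum]

/-- The weighted combination of `p` and `q`, on the disjoint union of their alphabets. -/
def mix (a b : ℝ) (p : α → ℝ) (q : β → ℝ) : α ⊕ β → ℝ :=
  Sum.elim (fun x => a * p x) (fun y => b * q y)

lemma marg_map_mix [Fintype α] [Fintype β] (f : α → γ) (g : β → δ) (a b : ℝ)
    (p : α → ℝ) (q : β → ℝ) :
    marg (Sum.map f g) (mix a b p q) = mix a b (marg f p) (marg g q) := by
  funext s
  cases s <;> simp [marg, mix, Fintype.sum_sum_type, Finset.mul_sum]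

lemma ent_mix [Fintype α] [Fintype β] (a b : ℝ) (p : α → ℝ) (q : β → ℝ) :
    ent (mix a b p q) = a * ent p + b * ent q +
      (Real.negMulLog a * ∑ x, p x + Real.negMulLog b * ∑ y, q y) := by
  simp only [ent, mix, Fintype.sum_sum_type, Sum.elim_inl, Sum.elim_inr, Real.negMulLog_mul,
    Finset.sum_add_distrib, ← Finset.mul_sum, ← Finset.sum_mul]
  ring

lemma condEnt_marg_mix {α₁ α₂ β₁ β₂ γ₁ γ₂ : Type}
    [Fintype α] [Fintype β] [Fintype γ] [Fintype α₁] [Fintype β₁] [Fintype γ₁]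
    [Fintype α₂] [Fintype β₂] [Fintype γ₂]
    {f : α → β} {g : α → γ} (f₁ : α₁ → β₁) (g₁ : α₁ → γ₁) (f₂ : α₂ → β₂) (g₂ : α₂ → γ₂)
    (e : α₁ ⊕ α₂ → α) {e' : (β₁ × γ₁) ⊕ (β₂ × γ₂) → β × γ} {e'' : γ₁ ⊕ γ₂ → γ}
    (he' : Function.Injective e') (he'' : Function.Injective e'')
    (hfg : (fun x => (f x, g x)) ∘ e =
      e' ∘ Sum.map (fun x => (f₁ x, g₁ x)) (fun x => (f₂ x, g₂ x)))
    (hg : g ∘ e = e'' ∘ Sum.map g₁ g₂) (a b : ℝ) (p : α₁ → ℝ) (q : α₂ → ℝ) :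
    condEnt f g (marg e (mix a b p q)) = a * condEnt f₁ g₁ p + b * condEnt f₂ g₂ q := by
  simp only [condEnt, marg_marg, hfg, hg]
  rw [← marg_marg, ← marg_marg, marg_map_mix, marg_map_mix, ent_marg_of_injective he',
    ent_marg_of_injective he'', ent_mix, ent_mix]
  simp only [sum_marg]
  ring

lemma KL_mix_le [Fintype α] [Fintype β] {a b : ℝ} (ha : 0 < a) (hb : 0 < b)
    (p q : α → ℝ) (r s : β → ℝ) :
    KL (mix a b p r) (mix a b q s) ≤ ENNReal.ofReal a * KL p q + ENNReal.ofReal b * KL r s := by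
  have ha' : ENNReal.ofReal a ≠ 0 := by simpa using ha
  have hb' : ENNReal.ofReal b ≠ 0 := by simpa using hb
  by_cases h₁ : ∀ x, q x = 0 → p x = 0
  swap
  · simp [KL, if_neg h₁, ENNReal.mul_top ha']
  by_cases h₂ : ∀ x, s x = 0 → r x = 0
  swap
  · simp [KL, if_neg h₂, ENNReal.mul_top hb']
  have h : ∀ x, mix a b q s x = 0 → mix a b p r x = 0 := by
    rintro (x | x) <;> simp only [mix, Sum.elim_inl, Sum.elim_inr, mul_eq_zero]
    · exact Or.imp_right (h₁ x)
    · exact Or.imp_right (h₂ x)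
  rw [KL, KL, KL, if_pos h, if_pos h₁, if_pos h₂, ← ENNReal.ofReal_mul ha.le,
    ← ENNReal.ofReal_mul hb.le]
  refine le_trans (ENNReal.ofReal_le_ofReal (le_of_eq ?_)) ENNReal.ofReal_add_le
  simp only [mix, Fintype.sum_sum_type, Sum.elim_inl, Sum.elim_inr,
    mul_div_mul_left _ _ ha.ne', mul_div_mul_left _ _ hb.ne', Finset.mul_sum, mul_assoc]

lemma IsDist.mix [Fintype α] [Fintype β] {a b : ℝ} (ha : 0 ≤ a) (hb : 0 ≤ b) (hab : a + b = 1)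
    {p : α → ℝ} {q : β → ℝ} (hp : IsDist p) (hq : IsDist q) : IsDist (mix a b p q) := by
  refine ⟨?_, ?_⟩
  · rintro (x | x)
    · exact mul_nonneg ha (hp.1 x)
    · exact mul_nonneg hb (hq.1 x)
  · simp [_root_.mix, Fintype.sum_sum_type, ← Finset.mul_sum, hp.2, hq.2, hab]

lemma IsDist.marg [Fintype α] [Fintype β] {p : α → ℝ} (hp : IsDist p) (f : α → β) :
    IsDist (marg f p) := by
  refine ⟨fun b => Finset.sum_nonneg fun a _ => ?_, (sum_marg f p).trans hp.2⟩
  split_ifs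
  exacts [hp.1 a, le_rfl]

lemma IsDist.nonempty [Fintype α] {p : α → ℝ} (hp : IsDist p) : Nonempty α := by
  by_contra h
  rw [not_nonempty_iff] at h
  simpa using hp.2

end Mixture

section Glue

variable {S T : Type} {m₁ m₂ l₁ l₂ : ℕ}

/-- A kernel that agrees with `K₁` on the first diagonal block, with `K₂` on the second one,
and is independent of the last coordinate elsewhere. -/
def glueKernel (v₁ : Fin l₁) (v₂ : Fin l₂) (K₁ : S × Fin m₁ × Fin l₁ → T → ℝ)
    (K₂ : S × Fin m₂ × Fin l₂ → T → ℝ) : S × Fin (m₁ + m₂) × Fin (l₁ + l₂) → T → ℝ :=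
  fun z => Fin.addCases (motive := fun _ => T → ℝ)
    (fun u => K₁ (z.1, u, Fin.addCases (motive := fun _ => Fin l₁) id (fun _ => v₁) z.2.2))
    (fun u => K₂ (z.1, u, Fin.addCases (motive := fun _ => Fin l₂) (fun _ => v₂) id z.2.2))
    z.2.1

lemma glueKernel_left (v₁ : Fin l₁) (v₂ : Fin l₂) (K₁ : S × Fin m₁ × Fin l₁ → T → ℝ)
    (K₂ : S × Fin m₂ × Fin l₂ → T → ℝ) (s : S) (u : Fin m₁) (v : Fin l₁) :
    glueKernel v₁ v₂ K₁ K₂ (s, Fin.castAdd m₂ u, Fin.castAdd l₂ v) = K₁ (s, u, v) := by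
  simp [glueKernel]

lemma glueKernel_right (v₁ : Fin l₁) (v₂ : Fin l₂) (K₁ : S × Fin m₁ × Fin l₁ → T → ℝ)
    (K₂ : S × Fin m₂ × Fin l₂ → T → ℝ) (s : S) (u : Fin m₂) (v : Fin l₂) :
    glueKernel v₁ v₂ K₁ K₂ (s, Fin.natAdd m₁ u, Fin.natAdd l₁ v) = K₂ (s, u, v) := by
  simp [glueKernel]

lemma IsKernel.glue [Fintype T] (v₁ : Fin l₁) (v₂ : Fin l₂) {K₁ : S × Fin m₁ × Fin l₁ → T → ℝ}
    {K₂ : S × Fin m₂ × Fin l₂ → T → ℝ} (h₁ : IsKernel K₁) (h₂ : IsKernel K₂) :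
    IsKernel (glueKernel v₁ v₂ K₁ K₂) := by
  rintro ⟨s, u, v⟩
  cases u using Fin.addCases with
  | left u => simpa [glueKernel] using h₁ (s, u, _)
  | right u => simpa [glueKernel] using h₂ (s, u, _)

lemma Fin.castAdd_ne_natAdd {m n : ℕ} (i : Fin m) (j : Fin n) :
    Fin.castAdd n i ≠ Fin.natAdd m j := by
  intro h
  have := congrArg Fin.val h
  simp at this
  omega

end Glue

lemma psiSet_mix_mem {X Y B : Type} [Fintype X] [Fintype Y] [Fintype B] (π : X × Y → ℝ)
    {t₁ t₂ a b : ℝ} (ha : 0 < a) (hb : 0 < b) (hab : a + b = 1) {d₁ d₂ : ℝ≥0∞}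
    (h₁ : d₁ ∈ psiSet X Y B π t₁) (h₂ : d₂ ∈ psiSet X Y B π t₂) :
    ∃ d ∈ psiSet X Y B π (a * t₁ + b * t₂), d ≤ ENNReal.ofReal a * d₁ + ENNReal.ofReal b * d₂ := by
  obtain ⟨m₁, l₁, P₁, PB₁, PY₁, hP₁, hPB₁, hPY₁, hc₁, rfl⟩ := h₁
  obtain ⟨m₂, l₂, P₂, PB₂, PY₂, hP₂, hPB₂, hPY₂, hc₂, rfl⟩ := h₂
  obtain ⟨-, v₁⟩ := hP₁.nonempty
  obtain ⟨-, v₂⟩ := hP₂.nonempty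
  have hne := @Fin.castAdd_ne_natAdd
  let eUV : (Fin m₁ × Fin l₁) ⊕ (Fin m₂ × Fin l₂) → Fin (m₁ + m₂) × Fin (l₁ + l₂) :=
    Sum.elim (Prod.map (Fin.castAdd m₂) (Fin.castAdd l₂)) (Prod.map (Fin.natAdd m₁) (Fin.natAdd l₁))
  let eV : Fin l₁ ⊕ Fin l₂ → Fin (l₁ + l₂) := Sum.elim (Fin.castAdd l₂) (Fin.natAdd l₁)
  let eXYV : (X × Y × Fin l₁) ⊕ (X × Y × Fin l₂) → X × Y × Fin (l₁ + l₂) :=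
    Sum.elim (fun z => (z.1, z.2.1, Fin.castAdd l₂ z.2.2))
      (fun z => (z.1, z.2.1, Fin.natAdd l₁ z.2.2))
  let eBUXYV : ((B × Fin m₁) × X × Y × Fin l₁) ⊕ ((B × Fin m₂) × X × Y × Fin l₂) →
      (B × Fin (m₁ + m₂)) × X × Y × Fin (l₁ + l₂) :=
    Sum.elim (fun z => ((z.1.1, Fin.castAdd m₂ z.1.2), z.2.1, z.2.2.1, Fin.castAdd l₂ z.2.2.2))
      (fun z => ((z.1.1, Fin.natAdd m₁ z.1.2), z.2.1, z.2.2.1, Fin.natAdd l₁ z.2.2.2))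
  let eXVY : (X × Fin l₁ × Y) ⊕ (X × Fin l₂ × Y) → X × Fin (l₁ + l₂) × Y :=
    Sum.elim (fun z => (z.1, Fin.castAdd l₂ z.2.1, z.2.2))
      (fun z => (z.1, Fin.natAdd l₁ z.2.1, z.2.2))
  let eAll : (X × Fin m₁ × Fin l₁ × B × Y) ⊕ (X × Fin m₂ × Fin l₂ × B × Y) →
      X × Fin (m₁ + m₂) × Fin (l₁ + l₂) × B × Y :=
    Sum.elim (fun z => (z.1, Fin.castAdd m₂ z.2.1, Fin.castAdd l₂ z.2.2.1, z.2.2.2))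
      (fun z => (z.1, Fin.natAdd m₁ z.2.1, Fin.natAdd l₁ z.2.2.1, z.2.2.2))
  have iUV : Function.Injective eUV := by
    rintro (⟨u, v⟩ | ⟨u, v⟩) (⟨u', v'⟩ | ⟨u', v'⟩) h <;>
      simp_all [eUV, (hne _ _).symm]
  have iV : Function.Injective eV := by
    rintro (v | v) (v' | v') h <;> simp_all [eV, (hne _ _).symm]
  have iXYV : Function.Injective eXYV := by
    rintro (⟨x, y, v⟩ | ⟨x, y, v⟩) (⟨x', y', v'⟩ | ⟨x', y', v'⟩) h <;>
      simp_all [eXYV, (hne _ _).symm]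
  have iBUXYV : Function.Injective eBUXYV := by
    rintro (⟨⟨c, u⟩, x, y, v⟩ | ⟨⟨c, u⟩, x, y, v⟩)
      (⟨⟨c', u'⟩, x', y', v'⟩ | ⟨⟨c', u'⟩, x', y', v'⟩) h <;>
      simp_all [eBUXYV, (hne _ _).symm]
  have iXVY : Function.Injective eXVY := by
    rintro (⟨x, v, y⟩ | ⟨x, v, y⟩) (⟨x', v', y'⟩ | ⟨x', v', y'⟩) h <;>
      simp_all [eXVY, (hne _ _).symm]
  have iAll : Function.Injective eAll := by
    rintro (⟨x, u, v, c, y⟩ | ⟨x, u, v, c, y⟩)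
      (⟨x', u', v', c', y'⟩ | ⟨x', u', v', c', y'⟩) h <;>
      simp_all [eAll, (hne _ _).symm]
  set P := marg eUV (mix a b P₁ P₂) with hP
  set PB := glueKernel v₁ v₂ PB₁ PB₂ with hPB
  set PY := glueKernel v₁ v₂ PY₁ PY₂ with hPY
  set J₁ := seqJoint (marg Prod.fst π) P₁ PB₁ PY₁ with hJ₁
  set J₂ := seqJoint (marg Prod.fst π) P₂ PB₂ PY₂ with hJ₂
  have hP_left : ∀ u v, P (Fin.castAdd m₂ u, Fin.castAdd l₂ v) = a * P₁ (u, v) := fun u v =>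
    marg_apply_of_injective iUV _ (Sum.inl (u, v))
  have hP_right : ∀ u v, P (Fin.natAdd m₁ u, Fin.natAdd l₁ v) = b * P₂ (u, v) := fun u v =>
    marg_apply_of_injective iUV _ (Sum.inr (u, v))
  have hJ : seqJoint (marg Prod.fst π) P PB PY = marg eAll (mix a b J₁ J₂) := by
    refine eq_marg_of_injective iAll ?_ ?_
    · rintro (⟨x, u, v, c, y⟩ | ⟨x, u, v, c, y⟩)
      · simp only [seqJoint, eAll, mix, Sum.elim_inl, hJ₁, hP_left, hPB, hPY, glueKernel_left]
        ring
      · simp only [seqJoint, eAll, mix, Sum.elim_inr, hJ₂, hP_right, hPB, hPY, glueKernel_right]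
        ring
    · rintro ⟨x, u, v, c, y⟩ hz
      have : P (u, v) = 0 := by
        refine marg_apply_of_notMem_range _ ?_
        rintro ⟨⟨u', v'⟩ | ⟨u', v'⟩, h⟩
        · cases h
          exact hz ⟨Sum.inl (x, u', v', c, y), rfl⟩
        · cases h
          exact hz ⟨Sum.inr (x, u', v', c, y), rfl⟩
      simp [seqJoint, this]
  refine ⟨_, ⟨m₁ + m₂, l₁ + l₂, P, PB, PY, (hP₁.mix ha.le hb.le hab hP₂).marg _,
    hPB₁.glue v₁ v₂ hPB₂, hPY₁.glue v₁ v₂ hPY₂, ?_, rfl⟩, ?_⟩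
  · rw [hJ, condEnt_marg_mix (fun q : X × Fin m₁ × Fin l₁ × B × Y => q.2.1) (fun q => q.2.2.1)
      (fun q : X × Fin m₂ × Fin l₂ × B × Y => q.2.1) (fun q => q.2.2.1) eAll iUV iV
      (by funext z; rcases z with z | z <;> rfl) (by funext z; rcases z with z | z <;> rfl),
      condEnt_marg_mix (fun q : X × Fin m₁ × Fin l₁ × B × Y => (q.2.2.2.1, q.2.1))
      (fun q => (q.1, q.2.2.2.2, q.2.2.1))
      (fun q : X × Fin m₂ × Fin l₂ × B × Y => (q.2.2.2.1, q.2.1))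
      (fun q => (q.1, q.2.2.2.2, q.2.2.1)) eAll iBUXYV iXYV
      (by funext z; rcases z with z | z <;> rfl) (by funext z; rcases z with z | z <;> rfl)]
    linarith [mul_le_mul_of_nonneg_left hc₁ ha.le, mul_le_mul_of_nonneg_left hc₂ hb.le]
  · have hV : marg Prod.snd P = marg eV (mix a b (marg Prod.snd P₁) (marg Prod.snd P₂)) := by
      rw [hP, ← marg_map_mix, marg_marg, marg_marg]
      congr 1
      funext z
      rcases z with z | z <;> rfl
    have hq : (fun r : X × Fin (l₁ + l₂) × Y => marg Prod.snd P r.2.1 * π (r.1, r.2.2)) =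
        marg eXVY (mix a b (fun r => marg Prod.snd P₁ r.2.1 * π (r.1, r.2.2))
          (fun r => marg Prod.snd P₂ r.2.1 * π (r.1, r.2.2))) := by
      refine eq_marg_of_injective iXVY ?_ ?_
      · rintro (⟨x, v, y⟩ | ⟨x, v, y⟩)
        · have := marg_apply_of_injective iV
            (mix a b (marg Prod.snd P₁) (marg Prod.snd P₂)) (Sum.inl v)
          simp only [eV, mix, Sum.elim_inl] at this
          simp only [eXVY, mix, Sum.elim_inl, hV, eV, this, mul_assoc]
        · have := marg_apply_of_injective iV
            (mix a b (marg Prod.snd P₁) (marg Prod.snd P₂)) (Sum.inr v)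
          simp only [eV, mix, Sum.elim_inr] at this
          simp only [eXVY, mix, Sum.elim_inr, hV, eV, this, mul_assoc]
      · rintro ⟨x, v, y⟩ hz
        refine absurd ?_ hz
        cases v using Fin.addCases with
        | left v => exact ⟨Sum.inl (x, v, y), rfl⟩
        | right v => exact ⟨Sum.inr (x, v, y), rfl⟩
    have hp : marg (fun q : X × Fin (m₁ + m₂) × Fin (l₁ + l₂) × B × Y => (q.1, q.2.2.1, q.2.2.2.2))
        (marg eAll (mix a b J₁ J₂)) =
        marg eXVY (mix a b (marg (fun q => (q.1, q.2.2.1, q.2.2.2.2)) J₁)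
          (marg (fun q => (q.1, q.2.2.1, q.2.2.2.2)) J₂)) := by
      rw [← marg_map_mix, marg_marg, marg_marg]
      congr 1
      funext z
      rcases z with z | z <;> rfl
    rw [hJ, hp, hq, KL_marg_of_injective iXVY]
    exact KL_mix_le ha hb _ _ _ _

/-- `Ψ` is nonincreasing and convex on `ℝ`. -/
theorem Psi_antitone_convex
    (X Y B : Type) [Fintype X] [Fintype Y] [Fintype B]
    (π : X × Y → ℝ) (hπ : IsDist π) :
    Antitone (Psi X Y B π) ∧
    ∀ t₁ t₂ a b : ℝ, 0 ≤ a → 0 ≤ b → a + b = 1 →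
      Psi X Y B π (a * t₁ + b * t₂) ≤
        ENNReal.ofReal a * Psi X Y B π t₁ + ENNReal.ofReal b * Psi X Y B π t₂ := by
  refine ⟨fun s t hst => sInf_le_sInf ?_, fun t₁ t₂ a b ha hb hab => ?_⟩
  · rintro d ⟨m, l, P, PB, PY, hP, hPB, hPY, hc, rfl⟩
    exact ⟨m, l, P, PB, PY, hP, hPB, hPY, by linarith, rfl⟩
  rcases ha.eq_or_lt with rfl | ha
  · obtain rfl : b = 1 := by linarith
    simp
  rcases hb.eq_or_lt with rfl | hb
  · obtain rfl : a = 1 := by linarith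
    simp
  have ha' : ENNReal.ofReal a ≠ 0 := by simpa using ha
  have hb' : ENNReal.ofReal b ≠ 0 := by simpa using hb
  simp only [Psi]
  rw [sInf_eq_iInf' (psiSet X Y B π t₁), sInf_eq_iInf' (psiSet X Y B π t₂),
    ENNReal.mul_iInf_of_ne ha' ENNReal.ofReal_ne_top,
    ENNReal.mul_iInf_of_ne hb' ENNReal.ofReal_ne_top]
  refine ENNReal.le_iInf_add_iInf fun d₁ d₂ => ?_
  obtain ⟨d, hd, hle⟩ := psiSet_mix_mem π ha hb hab d₁.2 d₂.2
  exact (sInf_le hd).trans hle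

end
end

section
/- Let 𝒳, 𝒴, 𝓑 be finite sets, π_{XY} a distribution on 𝒳×𝒴, and t ≥ 0. Consider Ψ(t), the minimum over finite auxiliary alphabets 𝒰, 𝒱 and distributions P_{UV}, P_{B|XUV}, P_{Y|BUV} satisfying H(U|V) ≤ H(BU|XYV) + t of D(P_{Y|XV} ‖ π_{Y|X} | π_X P_V), with entropies evaluated under π_X P_{UV} P_{B|XUV} P_{Y|BUV}. Then the value of Ψ(t) is unchanged if the minimization is further restricted to auxiliary alphabets with |𝒱| ≤ 2 and |𝒰| ≤ 2·|𝒳|·|𝒴|. -/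
open scoped BigOperators ENNReal
open Classical

noncomputable section

/-- Same as `psiSet`, but with the auxiliary alphabets restricted to
`|𝒱| ≤ 2` and `|𝒰| ≤ 2·|𝒳|·|𝒴|`. -/
def psiSetBdd (X Y B : Type) [Fintype X] [Fintype Y] [Fintype B] (π : X × Y → ℝ) (t : ℝ) :
    Set ℝ≥0∞ :=
  { d | ∃ (m l : ℕ), m ≤ 2 * Fintype.card X * Fintype.card Y ∧ l ≤ 2 ∧
      ∃ (PUV : Fin m × Fin l → ℝ)
        (PB : X × Fin m × Fin l → B → ℝ) (PY : B × Fin m × Fin l → Y → ℝ),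
      IsDist PUV ∧ IsKernel PB ∧ IsKernel PY ∧
      condEnt (fun q : X × Fin m × Fin l × B × Y => q.2.1)
          (fun q => q.2.2.1) (seqJoint (marg Prod.fst π) PUV PB PY) ≤
        condEnt (fun q : X × Fin m × Fin l × B × Y => (q.2.2.2.1, q.2.1))
          (fun q => (q.1, q.2.2.2.2, q.2.2.1)) (seqJoint (marg Prod.fst π) PUV PB PY) + t ∧
      d = KL (marg (fun q : X × Fin m × Fin l × B × Y => (q.1, q.2.2.1, q.2.2.2.2))
              (seqJoint (marg Prod.fst π) PUV PB PY))
            (fun r : X × Fin l × Y => marg Prod.snd PUV r.2.1 * π (r.1, r.2.2)) }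

lemma exists_sum_eq_zero_of_card_lt {ι κ : Type} [Fintype ι] [Fintype κ] (f : ι → κ → ℝ)
    (s : Finset ι) (hs : Fintype.card κ < s.card) :
    ∃ g : ι → ℝ, g ≠ 0 ∧ (∀ i, i ∉ s → g i = 0) ∧ ∀ k, ∑ i, g i * f i k = 0 := by
  have hdep : ¬ LinearIndependent ℝ (fun i : s => f i) := fun h => by
    have := h.fintype_card_le_finrank
    simp at this
    omega
  obtain ⟨g, hg, i, hi⟩ := Fintype.not_linearIndependent_iff.1 hdep
  refine ⟨fun i => if h : i ∈ s then g ⟨i, h⟩ else 0, fun h => hi ?_, fun i hi => by simp [hi],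
    fun k => ?_⟩
  · simpa using congrFun h i
  · have hk := congrFun hg k
    simp only [Finset.sum_apply, Pi.smul_apply, smul_eq_mul, Pi.zero_apply] at hk
    refine Eq.trans ?_ hk
    rw [← Finset.sum_subset (Finset.subset_univ s) (fun i _ hi => by simp [hi]),
      ← Finset.sum_coe_sort s]
    exact Finset.sum_congr rfl fun i _ => by simp

/-- A feasible point of a linear program with `card κ` equality constraints can be improved to one
supported on at most `card κ` coordinates. -/
lemma exists_small_support {ι κ : Type} [Fintype ι] [Fintype κ] (f : ι → κ → ℝ) (c : ι → ℝ)
    (hf : ∀ g : ι → ℝ, (∀ k, ∑ i, g i * f i k = 0) → ∑ i, g i = 0)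
    (w : ι → ℝ) (hw : ∀ i, 0 ≤ w i) :
    ∃ w' : ι → ℝ, (∀ i, 0 ≤ w' i) ∧ (∀ i, w i = 0 → w' i = 0) ∧
      (∀ k, ∑ i, w' i * f i k = ∑ i, w i * f i k) ∧ ∑ i, w' i * c i ≤ ∑ i, w i * c i ∧
      (Finset.univ.filter fun i => w' i ≠ 0).card ≤ Fintype.card κ := by
  induction hn : (Finset.univ.filter fun i => w i ≠ 0).card using Nat.strong_induction_on
    generalizing w with
  | _ n ih =>
  by_cases hle : n ≤ Fintype.card κ
  · exact ⟨w, hw, fun _ h => h, fun _ => rfl, le_rfl, hn ▸ hle⟩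
  obtain ⟨g, hg0, hgs, hgf, hgc⟩ : ∃ g : ι → ℝ, g ≠ 0 ∧ (∀ i, w i = 0 → g i = 0) ∧
      (∀ k, ∑ i, g i * f i k = 0) ∧ ∑ i, g i * c i ≤ 0 := by
    obtain ⟨g, hg0, hgs, hgf⟩ := exists_sum_eq_zero_of_card_lt f
      (Finset.univ.filter fun i => w i ≠ 0) (by omega)
    rcases le_total (∑ i, g i * c i) 0 with h | h
    · exact ⟨g, hg0, fun i hi => hgs i (by simp [hi]), hgf, h⟩
    · exact ⟨-g, neg_ne_zero.2 hg0, fun i hi => by simp [hgs i (by simp [hi])],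
        fun k => by simp [hgf k], by simpa using h⟩
  obtain ⟨j, hj⟩ : ∃ j, g j < 0 := by
    by_contra! hpos
    exact hg0 (funext fun i =>
      (Finset.sum_eq_zero_iff_of_nonneg fun i _ => hpos i).1 (hf g hgf) i (Finset.mem_univ i))
  obtain ⟨i₀, hi₀, hmin⟩ := Finset.exists_min_image (Finset.univ.filter fun i => g i < 0)
    (fun i => w i / -g i) ⟨j, by simpa using hj⟩
  simp only [Finset.mem_filter, Finset.mem_univ, true_and] at hi₀ hmin
  set s := w i₀ / -g i₀ with hs
  have hs0 : 0 ≤ s := div_nonneg (hw _) (by linarith)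
  have hsum : ∀ φ : ι → ℝ, ∑ i, (w i + s * g i) * φ i
      = ∑ i, w i * φ i + s * ∑ i, g i * φ i := fun φ => by
    rw [Finset.mul_sum, ← Finset.sum_add_distrib]
    exact Finset.sum_congr rfl fun i _ => by ring
  have hzero : w i₀ + s * g i₀ = 0 := by
    rw [hs]
    field_simp [hi₀.ne]
    ring
  have hi₀w : w i₀ ≠ 0 := fun h => hi₀.ne (hgs _ h)
  have hlt : (Finset.univ.filter fun i => w i + s * g i ≠ 0).card < n := by
    rw [← hn]
    refine Finset.card_lt_card ⟨fun i hi => ?_, fun h => ?_⟩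
    · simp only [Finset.mem_filter, Finset.mem_univ, true_and] at hi ⊢
      exact fun h => hi (by rw [h, hgs i h]; ring)
    · exact absurd (h (x := i₀) (by simpa using hi₀w)) (by simp [hzero])
  obtain ⟨w', h0, hsupp, heq, hc, hcard⟩ := ih _ hlt (fun i => w i + s * g i) (fun i => by
    rcases lt_or_ge (g i) 0 with h | h
    · have := (le_div_iff₀ (neg_pos.2 h)).1 (hmin i h)
      linarith
    · exact add_nonneg (hw i) (mul_nonneg hs0 h)) rfl
  refine ⟨w', h0, fun i hi => hsupp i (by simp [hi, hgs i hi]), fun k => ?_, hc.trans ?_, hcard⟩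
  · rw [heq, hsum, hgf, mul_zero, add_zero]
  · rw [hsum]
    nlinarith

/-- Reindexed form of `exists_small_support`, with the new weights carried by `Fin n`. -/
lemma exists_small_reindexing {ι κ : Type} [Fintype ι] [Nonempty ι] [Fintype κ] {n : ℕ}
    (hκ : Fintype.card κ = n) (f : ι → κ → ℝ) (c : ι → ℝ)
    (hf : ∀ g : ι → ℝ, (∀ k, ∑ i, g i * f i k = 0) → ∑ i, g i = 0)
    (w : ι → ℝ) (hw : ∀ i, 0 ≤ w i) :
    ∃ (e : Fin n → ι) (w' : Fin n → ℝ), (∀ j, 0 ≤ w' j) ∧ (∀ j, w (e j) = 0 → w' j = 0) ∧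
      (∀ k, ∑ j, w' j * f (e j) k = ∑ i, w i * f i k) ∧
      ∑ j, w' j * c (e j) ≤ ∑ i, w i * c i := by
  obtain ⟨w₁, h0, hsupp, heq, hc, hcard⟩ := exists_small_support f c hf w hw
  set S := Finset.univ.filter fun i => w₁ i ≠ 0 with hS
  obtain ⟨emb⟩ : Nonempty (S ↪ Fin n) :=
    Function.Embedding.nonempty_of_card_le (by simpa [← hκ] using hcard)
  let e : Fin n → ι := Function.extend emb Subtype.val fun _ => Classical.arbitrary ι
  let w₂ : Fin n → ℝ := Function.extend emb (fun i : S => w₁ i) fun _ => 0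
  have he : ∀ i : S, e (emb i) = i := fun i => emb.injective.extend_apply _ _ _
  have hw₂ : ∀ i : S, w₂ (emb i) = w₁ i := fun i => emb.injective.extend_apply _ _ _
  have hw₂' : ∀ j, j ∉ Set.range emb → w₂ j = 0 := fun j hj =>
    Function.extend_apply' _ _ _ hj
  have hsum : ∀ φ : ι → ℝ, ∑ j, w₂ j * φ (e j) = ∑ i, w₁ i * φ i := fun φ => by
    rw [← Finset.sum_subset (Finset.subset_univ S)
      (fun i _ hi => by simp only [hS, Finset.mem_filter, Finset.mem_univ, true_and, not_not] at hi
                        simp [hi]), ← Finset.sum_coe_sort S]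
    exact (Fintype.sum_of_injective emb emb.injective _ _ (fun j hj => by simp [hw₂' j hj])
      (fun i => by rw [he, hw₂])).symm
  refine ⟨e, w₂, fun j => ?_, fun j hj => ?_, fun k => ?_, ?_⟩
  · by_cases h : j ∈ Set.range emb
    · obtain ⟨i, rfl⟩ := h
      exact (hw₂ i).symm ▸ h0 i
    · exact (hw₂' j h).ge
  · by_cases h : j ∈ Set.range emb
    · obtain ⟨i, rfl⟩ := h
      rw [he] at hj
      rw [hw₂, hsupp _ hj]
    · exact hw₂' j h
  · rw [hsum fun i => f i k, heq]
  · rw [hsum c]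
    exact hc

/-- The conditional law of `(X, B, Y)` given `(U, V) = (u, v)`. -/
def condLaw {X Y B U V : Type} (πX : X → ℝ) (PB : X × U × V → B → ℝ) (PY : B × U × V → Y → ℝ)
    (u : U) (v : V) : X × B × Y → ℝ :=
  fun r => πX r.1 * PB (r.1, u, v) r.2.1 * PY (r.2.1, u, v) r.2.2

/-- The conditional law of `(X, Y)` given `(U, V) = (u, v)`. -/
def condLawXY {X Y B U V : Type} [Fintype B] (πX : X → ℝ) (PB : X × U × V → B → ℝ)
    (PY : B × U × V → Y → ℝ) (u : U) (v : V) : X × Y → ℝ :=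
  fun r => ∑ b, condLaw πX PB PY u v (r.1, b, r.2)

/-- The contribution to `H(XY|V) - H(BXY|UV)` of a value of `V` with probability `w`, unnormalised
conditional law `M` of `(X, Y)` and unnormalised conditional entropy `h` of `(B, X, Y)`. -/
def entGap {α : Type} [Fintype α] (M : α → ℝ) (w h : ℝ) : ℝ :=
  ent M - Real.negMulLog w - h

/-- The contribution to the conditional divergence of a value of `V` with probability `w` and
unnormalised conditional law `M` of `(X, Y)`. -/
def klTerm {α : Type} [Fintype α] (π M : α → ℝ) (w : ℝ) : ℝ :=
  ∑ r, M r * Real.log (M r / (w * π r))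

lemma ent_smul {α : Type} [Fintype α] (c : ℝ) (M : α → ℝ) :
    ent (fun r => c * M r) = (∑ r, M r) * Real.negMulLog c + c * ent M := by
  simp only [ent, Real.negMulLog_mul, Finset.sum_add_distrib, Finset.sum_mul, Finset.mul_sum]

lemma entGap_smul {α : Type} [Fintype α] (c : ℝ) (M : α → ℝ) (w h : ℝ) (hM : ∑ r, M r = w) :
    entGap (fun r => c * M r) (c * w) (c * h) = c * entGap M w h := by
  rw [entGap, entGap, ent_smul, Real.negMulLog_mul, hM]
  ring

lemma klTerm_smul {α : Type} [Fintype α] (π : α → ℝ) (c : ℝ) (M : α → ℝ) (w : ℝ) :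
    klTerm π (fun r => c * M r) (c * w) = c * klTerm π M w := by
  rcases eq_or_ne c 0 with rfl | hc
  · simp [klTerm]
  · simp only [klTerm, Finset.mul_sum, mul_assoc, mul_div_mul_left _ _ hc]

section Marginals

variable {X Y B U V : Type} [Fintype X] [Fintype Y] [Fintype B]
  {πX : X → ℝ} {PB : X × U × V → B → ℝ} {PY : B × U × V → Y → ℝ}

lemma sum_condLaw (hX : IsDist πX) (hB : IsKernel PB) (hY : IsKernel PY) (u : U) (v : V) :
    ∑ r, condLaw πX PB PY u v r = 1 := by
  simp only [condLaw, Fintype.sum_prod_type, ← Finset.mul_sum, (hY _).2, (hB _).2, mul_one, hX.2]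

lemma sum_condLawXY (hX : IsDist πX) (hB : IsKernel PB) (hY : IsKernel PY) (u : U) (v : V) :
    ∑ r, condLawXY πX PB PY u v r = 1 := by
  rw [← sum_condLaw hX hB hY u v]
  simp only [condLawXY, Fintype.sum_prod_type]
  exact Finset.sum_congr rfl fun x _ => Finset.sum_comm

variable [Fintype U] [Fintype V]

lemma marg_snd (p : U × V → ℝ) (v : V) : marg Prod.snd p v = ∑ u, p (u, v) := by
  simp [marg, Fintype.sum_prod_type]

lemma marg_seqJoint_uv (hX : IsDist πX) (hB : IsKernel PB) (hY : IsKernel PY) (PUV : U × V → ℝ)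
    (u : U) (v : V) :
    marg (fun q : X × U × V × B × Y => (q.2.1, q.2.2.1)) (seqJoint πX PUV PB PY) (u, v)
      = PUV (u, v) := by
  trans PUV (u, v) * ∑ r, condLaw πX PB PY u v r
  · simp only [marg, Fintype.sum_prod_type, Prod.mk.injEq, ite_and, condLaw, Finset.mul_sum,
      seqJoint]
    refine Finset.sum_congr rfl fun x _ => ?_
    simp [Finset.sum_ite_irrel]
    refine Finset.sum_congr rfl fun b _ => Finset.sum_congr rfl fun y _ => ?_
    ring
  · rw [sum_condLaw hX hB hY, mul_one]

lemma marg_seqJoint_v (hX : IsDist πX) (hB : IsKernel PB) (hY : IsKernel PY) (PUV : U × V → ℝ)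
    (v : V) :
    marg (fun q : X × U × V × B × Y => q.2.2.1) (seqJoint πX PUV PB PY) v
      = ∑ u, PUV (u, v) := by
  simp only [← marg_seqJoint_uv hX hB hY PUV]
  simp only [marg, Prod.mk.injEq, ite_and]
  rw [Finset.sum_comm]
  simp

lemma marg_seqJoint_full (PUV : U × V → ℝ) (x : X) (u : U) (v : V) (b : B) (y : Y) :
    marg (fun q : X × U × V × B × Y => ((q.2.2.2.1, q.2.1), (q.1, q.2.2.2.2, q.2.2.1)))
      (seqJoint πX PUV PB PY) ((b, u), (x, y, v)) = PUV (u, v) * condLaw πX PB PY u v (x, b, y) := by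
  have : ∀ q : X × U × V × B × Y, (((q.2.2.2.1, q.2.1), (q.1, q.2.2.2.2, q.2.2.1)) =
      ((b, u), (x, y, v))) ↔ q = (x, u, v, b, y) := by
    rintro ⟨x', u', v', b', y'⟩
    simp only [Prod.mk.injEq]
    tauto
  simp only [marg, this, Finset.sum_ite_eq', Finset.mem_univ, if_true, seqJoint, condLaw]
  ring

lemma marg_seqJoint_xyv (PUV : U × V → ℝ) (x : X) (v : V) (y : Y) :
    marg (fun q : X × U × V × B × Y => (q.1, q.2.2.2.2, q.2.2.1)) (seqJoint πX PUV PB PY) (x, y, v)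
      = ∑ u, PUV (u, v) * condLawXY πX PB PY u v (x, y) := by
  simp only [marg, Fintype.sum_prod_type, Prod.mk.injEq, ite_and, condLawXY, condLaw,
    Finset.mul_sum, seqJoint]
  simp [Finset.sum_ite_irrel]
  refine Finset.sum_congr rfl fun u _ => Finset.sum_congr rfl fun b _ => ?_
  ring

lemma marg_seqJoint_xvy (PUV : U × V → ℝ) (x : X) (v : V) (y : Y) :
    marg (fun q : X × U × V × B × Y => (q.1, q.2.2.1, q.2.2.2.2)) (seqJoint πX PUV PB PY) (x, v, y)
      = ∑ u, PUV (u, v) * condLawXY πX PB PY u v (x, y) := by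
  rw [← marg_seqJoint_xyv]
  simp only [marg, Prod.mk.injEq, and_comm]

lemma constraint_iff (hX : IsDist πX) (hB : IsKernel PB) (hY : IsKernel PY) (PUV : U × V → ℝ)
    (t : ℝ) :
    condEnt (fun q : X × U × V × B × Y => q.2.1) (fun q => q.2.2.1) (seqJoint πX PUV PB PY) ≤
        condEnt (fun q : X × U × V × B × Y => (q.2.2.2.1, q.2.1))
          (fun q => (q.1, q.2.2.2.2, q.2.2.1)) (seqJoint πX PUV PB PY) + t ↔
      ∑ v, entGap (fun r => ∑ u, PUV (u, v) * condLawXY πX PB PY u v r) (∑ u, PUV (u, v))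
        (∑ u, PUV (u, v) * ent (condLaw πX PB PY u v)) ≤ t := by
  have huv : ent (marg (fun q : X × U × V × B × Y => (q.2.1, q.2.2.1)) (seqJoint πX PUV PB PY))
      = ent PUV := congrArg ent (funext fun _ => marg_seqJoint_uv hX hB hY PUV _ _)
  have hv : ent (marg (fun q : X × U × V × B × Y => q.2.2.1) (seqJoint πX PUV PB PY))
      = ∑ v, Real.negMulLog (∑ u, PUV (u, v)) :=
    Finset.sum_congr rfl fun v _ => by rw [marg_seqJoint_v hX hB hY]
  have hfull : ent (marg (fun q : X × U × V × B × Y =>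
      ((q.2.2.2.1, q.2.1), (q.1, q.2.2.2.2, q.2.2.1))) (seqJoint πX PUV PB PY))
      = ent PUV + ∑ v, ∑ u, PUV (u, v) * ent (condLaw πX PB PY u v) := by
    trans ∑ v, ∑ u, ent (fun r => PUV (u, v) * condLaw πX PB PY u v r)
    · let e : (B × U) × X × Y × V ≃ V × U × X × B × Y :=
        { toFun := fun q => (q.2.2.2, q.1.2, q.2.1, q.1.1, q.2.2.1)
          invFun := fun q => ((q.2.2.2.1, q.2.1), (q.2.2.1, q.2.2.2.2, q.1))
          left_inv := fun _ => rfl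
          right_inv := fun _ => rfl }
      trans ∑ q : V × U × X × B × Y,
        Real.negMulLog (PUV (q.2.1, q.1) * condLaw πX PB PY q.2.1 q.1 q.2.2)
      · exact Fintype.sum_equiv e _ _ fun q =>
          congrArg Real.negMulLog (marg_seqJoint_full PUV _ _ _ _ _)
      · simp only [ent, Fintype.sum_prod_type]
    · simp only [ent_smul, sum_condLaw hX hB hY, one_mul, Finset.sum_add_distrib]
      rw [ent, Fintype.sum_prod_type, Finset.sum_comm]
  have hxyv : ent (marg (fun q : X × U × V × B × Y => (q.1, q.2.2.2.2, q.2.2.1))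
      (seqJoint πX PUV PB PY))
      = ∑ v, ent (fun r => ∑ u, PUV (u, v) * condLawXY πX PB PY u v r) := by
    let e : X × Y × V ≃ V × X × Y :=
      { toFun := fun q => (q.2.2, q.1, q.2.1)
        invFun := fun q => (q.2.1, q.2.2, q.1)
        left_inv := fun _ => rfl
        right_inv := fun _ => rfl }
    trans ∑ q : V × X × Y,
      Real.negMulLog (∑ u, PUV (u, q.1) * condLawXY πX PB PY u q.1 q.2)
    · exact Fintype.sum_equiv e _ _ fun q =>
        congrArg Real.negMulLog (marg_seqJoint_xyv PUV _ _ _)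
    · simp only [ent, Fintype.sum_prod_type]
  simp only [condEnt, entGap, Finset.sum_sub_distrib]
  rw [huv, hv, hfull, hxyv]
  constructor <;> intro h <;> linarith

lemma KL_seqJoint (π : X × Y → ℝ) (PUV : U × V → ℝ) :
    KL (marg (fun q : X × U × V × B × Y => (q.1, q.2.2.1, q.2.2.2.2)) (seqJoint πX PUV PB PY))
        (fun r : X × V × Y => marg Prod.snd PUV r.2.1 * π (r.1, r.2.2)) =
      if ∀ v r, (∑ u, PUV (u, v)) * π r = 0 → ∑ u, PUV (u, v) * condLawXY πX PB PY u v r = 0 then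
        ENNReal.ofReal (∑ v, klTerm π (fun r => ∑ u, PUV (u, v) * condLawXY πX PB PY u v r)
          (∑ u, PUV (u, v)))
      else ⊤ := by
  have hiff : (∀ a : X × V × Y, marg Prod.snd PUV a.2.1 * π (a.1, a.2.2) = 0 →
      marg (fun q : X × U × V × B × Y => (q.1, q.2.2.1, q.2.2.2.2)) (seqJoint πX PUV PB PY) a = 0)
      ↔ ∀ v r, (∑ u, PUV (u, v)) * π r = 0 →
        ∑ u, PUV (u, v) * condLawXY πX PB PY u v r = 0 := by
    simp only [Prod.forall, marg_seqJoint_xvy, marg_snd]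
    exact ⟨fun h v x y => h x v y, fun h x v y => h v x y⟩
  simp only [KL, hiff]
  congr 2
  simp only [klTerm, Fintype.sum_prod_type, marg_seqJoint_xvy, marg_snd]
  exact Finset.sum_comm

end Marginals

lemma isDist_marg_fst {α β : Type} [Fintype α] [Fintype β] {p : α × β → ℝ} (hp : IsDist p) :
    IsDist (marg Prod.fst p) := by
  have h : ∀ a, marg Prod.fst p a = ∑ b, p (a, b) := fun a => by
    rw [marg, Fintype.sum_prod_type_right]
    simp
  refine ⟨fun a => (h a).symm ▸ Finset.sum_nonneg fun b _ => hp.1 _, ?_⟩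
  simp only [h, ← hp.2, Fintype.sum_prod_type]

/-- For a fixed value of `V`, the alphabet of `U` can be shrunk to `card α` letters keeping the
average law `∑ u, p u * F u` and not decreasing the average of `h`. -/
lemma exists_reduce_u {U α : Type} [Fintype U] [Nonempty U] [Fintype α] {n : ℕ}
    (hn : Fintype.card α = n) (F : U → α → ℝ) (hF : ∀ u, ∑ a, F u a = 1) (h p : U → ℝ)
    (hp : ∀ u, 0 ≤ p u) :
    ∃ (e : Fin n → U) (p' : Fin n → ℝ), (∀ j, 0 ≤ p' j) ∧
      (∀ a, ∑ j, p' j * F (e j) a = ∑ u, p u * F u a) ∧ ∑ j, p' j = ∑ u, p u ∧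
      ∑ u, p u * h u ≤ ∑ j, p' j * h (e j) := by
  have hmass : ∀ {J : Type} [Fintype J] (e : J → U) (g : J → ℝ),
      ∑ a, ∑ j, g j * F (e j) a = ∑ j, g j := fun e g => by
    rw [Finset.sum_comm]
    simp only [← Finset.mul_sum, hF, mul_one]
  obtain ⟨e, p', h0, -, heq, hc⟩ := exists_small_reindexing hn F (fun u => -h u)
    (fun g hg => by rw [← hmass id g]; exact Finset.sum_eq_zero fun a _ => hg a) p hp
  refine ⟨e, p', h0, heq, ?_, by simpa using hc⟩
  rw [← hmass e, ← hmass id]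
  exact Finset.sum_congr rfl fun a _ => heq a

/-- The alphabet of `V` can be shrunk to two letters keeping the average of `G / w` and not
increasing the average of `D / w`. -/
lemma exists_reduce_v {V : Type} [Fintype V] [Nonempty V] (w G D : V → ℝ) (hw : ∀ v, 0 ≤ w v)
    (hG : ∀ v, w v = 0 → G v = 0) (hD : ∀ v, w v = 0 → D v = 0) :
    ∃ (e : Fin 2 → V) (w' : Fin 2 → ℝ), (∀ k, 0 ≤ w' k) ∧ (∀ k, w (e k) = 0 → w' k = 0) ∧
      ∑ k, w' k = ∑ v, w v ∧ ∑ k, w' k / w (e k) * G (e k) = ∑ v, G v ∧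
      ∑ k, w' k / w (e k) * D (e k) ≤ ∑ v, D v := by
  have hcancel : ∀ {A : V → ℝ}, (∀ v, w v = 0 → A v = 0) → ∀ v, w v * (A v / w v) = A v :=
    fun {A} hA v => by
      rcases eq_or_ne (w v) 0 with h | h
      · simp [h, hA v h]
      · field_simp
  obtain ⟨e, w', h0, hsupp, heq, hc⟩ := exists_small_reindexing (n := 2) (κ := Fin 2) (by simp)
    (fun v => ![1, G v / w v]) (fun v => D v / w v) (fun g hg => by simpa using hg 0) w hw
  have h1 := heq 0
  have h2 := heq 1
  simp only [Matrix.cons_val_zero, Matrix.cons_val_one, mul_one, hcancel hG] at h1 h2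
  simp only [hcancel hD] at hc
  exact ⟨e, w', h0, hsupp, h1, by rw [← h2]; exact Finset.sum_congr rfl fun k _ => by ring,
    hc.trans' (Finset.sum_le_sum fun k _ => by rw [div_mul_eq_mul_div, mul_div_assoc])⟩

lemma exists_mem_psiSetBdd_le {X Y B : Type} [Fintype X] [Fintype Y] [Fintype B]
    {π : X × Y → ℝ} (hπ : IsDist π) {t : ℝ} {d : ℝ≥0∞} (hd : d ∈ psiSet X Y B π t)
    (hd_top : d ≠ ⊤) : ∃ d' ∈ psiSetBdd X Y B π t, d' ≤ d := by
  obtain ⟨m, l, PUV, PB, PY, hP, hB, hY, hcon, rfl⟩ := hd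
  have hX := isDist_marg_fst hπ
  rw [KL_seqJoint] at hd_top ⊢
  rw [constraint_iff hX hB hY] at hcon
  split_ifs at hd_top ⊢ with hac
  swap
  · exact absurd rfl hd_top
  obtain ⟨⟨u₀, v₀⟩⟩ : Nonempty (Fin m × Fin l) := by
    by_contra hempty
    rw [not_nonempty_iff] at hempty
    simpa using hP.2
  have : Nonempty (Fin m) := ⟨u₀⟩
  have : Nonempty (Fin l) := ⟨v₀⟩
  set πX := marg Prod.fst π
  set w : Fin l → ℝ := fun v => ∑ u, PUV (u, v) with hw
  set M : Fin l → X × Y → ℝ := fun v r => ∑ u, PUV (u, v) * condLawXY πX PB PY u v r with hM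
  have hw0 : ∀ v, 0 ≤ w v := fun v => Finset.sum_nonneg fun u _ => hP.1 _
  have hw1 : ∑ v, w v = 1 := by rw [← hP.2, Fintype.sum_prod_type_right]
  choose a p hp0 hpM hpw hph using fun v => exists_reduce_u (Fintype.card_prod X Y)
    (fun u => condLawXY πX PB PY u v) (fun u => sum_condLawXY hX hB hY u v)
    (fun u => ent (condLaw πX PB PY u v)) (fun u => PUV (u, v)) (fun u => hP.1 _)
  set H : Fin l → ℝ := fun v => ∑ j, p v j * ent (condLaw πX PB PY (a v j) v) with hH
  have hMw : ∀ v, ∑ r, M v r = w v := fun v => by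
    simp only [hM, hw]
    rw [Finset.sum_comm]
    simp only [← Finset.mul_sum, sum_condLawXY hX hB hY, mul_one]
  have hM_zero : ∀ v, w v = 0 → M v = 0 := fun v hv => by
    have h := fun u => (Finset.sum_eq_zero_iff_of_nonneg fun u _ => hP.1 (u, v)).1 hv u
      (Finset.mem_univ u)
    funext r
    simp [hM, h]
  have hH_zero : ∀ v, w v = 0 → H v = 0 := fun v hv => by
    have h := fun j => (Finset.sum_eq_zero_iff_of_nonneg fun j _ => hp0 v j).1
      ((hpw v).trans hv) j (Finset.mem_univ j)
    simp [hH, h]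
  obtain ⟨e, w', hw'0, hsupp, hw'1, hG, hD⟩ := exists_reduce_v w (fun v => entGap (M v) (w v) (H v))
    (fun v => klTerm π (M v) (w v)) hw0
    (fun v hv => by simp [entGap, ent, hM_zero v hv, hH_zero v hv, hv])
    (fun v hv => by simp [klTerm, hM_zero v hv])
  set P' : Fin (Fintype.card X * Fintype.card Y) × Fin 2 → ℝ :=
    fun q => w' q.2 / w (e q.2) * p (e q.2) q.1 with hP'
  set PB' : X × Fin (Fintype.card X * Fintype.card Y) × Fin 2 → B → ℝ :=
    fun q => PB (q.1, a (e q.2.2) q.2.1, e q.2.2)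
  set PY' : B × Fin (Fintype.card X * Fintype.card Y) × Fin 2 → Y → ℝ :=
    fun q => PY (q.1, a (e q.2.2) q.2.1, e q.2.2)
  have hdiv : ∀ k, w' k / w (e k) * w (e k) = w' k := fun k =>
    div_mul_cancel_of_imp (hsupp k)
  have hmass : ∀ k, ∑ j, P' (j, k) = w' k / w (e k) * w (e k) := fun k => by
    simp only [hP', ← Finset.mul_sum, hpw, hw]
  have hlaw : ∀ k r, ∑ j, P' (j, k) * condLawXY πX PB' PY' j k r
      = w' k / w (e k) * M (e k) r := fun k r => by
    simp only [hM, ← hpM, Finset.mul_sum, hP', mul_assoc]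
    rfl
  have hent : ∀ k, ∑ j, P' (j, k) * ent (condLaw πX PB' PY' j k)
      = w' k / w (e k) * H (e k) := fun k => by
    simp only [hH, Finset.mul_sum, hP', mul_assoc]
    rfl
  have hB' : IsKernel PB' := fun q => hB _
  have hY' : IsKernel PY' := fun q => hY _
  refine ⟨_, ⟨_, 2, ?_, le_rfl, P', PB', PY', ⟨fun q => ?_, ?_⟩, hB', hY', ?_, rfl⟩, ?_⟩
  · exact Nat.mul_le_mul_right _ (by omega)
  · exact mul_nonneg (div_nonneg (hw'0 _) (hw0 _)) (hp0 _ _)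
  · rw [Fintype.sum_prod_type_right]
    simp only [hmass, hdiv]
    rw [hw'1, hw1]
  · rw [constraint_iff hX hB' hY']
    simp only [hmass, hlaw, hent, entGap_smul _ _ _ _ (hMw _)]
    rw [hG]
    refine (Finset.sum_le_sum fun v _ => ?_).trans hcon
    exact sub_le_sub_left (hph v) _
  · rw [KL_seqJoint (πX := πX), if_pos]
    · simp only [hmass, hlaw, klTerm_smul]
      exact ENNReal.ofReal_le_ofReal hD
    · intro k r hk
      rw [hmass, mul_assoc] at hk
      rw [hlaw]
      rcases mul_eq_zero.1 hk with h | h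
      · rw [h, zero_mul]
      · rw [show M (e k) r = 0 from hac _ _ h, mul_zero]

lemma psiSetBdd_subset_psiSet (X Y B : Type) [Fintype X] [Fintype Y] [Fintype B]
    (π : X × Y → ℝ) (t : ℝ) : psiSetBdd X Y B π t ⊆ psiSet X Y B π t :=
  fun _ ⟨m, l, _, _, h⟩ => ⟨m, l, h⟩

/-- for `t ≥ 0`, `Ψ(t)` is unchanged when the minimization is
restricted to auxiliary alphabets with `|𝒱| ≤ 2` and `|𝒰| ≤ 2·|𝒳|·|𝒴|`. -/
theorem Psi_cardinality_bound
    (X Y B : Type) [Fintype X] [Fintype Y] [Fintype B]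
    (π : X × Y → ℝ) (hπ : IsDist π) (t : ℝ) (ht : 0 ≤ t) :
    Psi X Y B π t = sInf (psiSetBdd X Y B π t) := by
  refine le_antisymm (sInf_le_sInf (psiSetBdd_subset_psiSet X Y B π t)) (le_sInf fun d hd => ?_)
  rcases eq_or_ne d ⊤ with rfl | hd_top
  · exact le_top
  · obtain ⟨d', hd', hle⟩ := exists_mem_psiSetBdd_le hπ hd hd_top
    exact (sInf_le hd').trans hle

end
end
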